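/- arXiv:2003.01035 — 2 statements merged into one kernel-verified Lean document; each statement's English description precedes it below -/
import Mathlib

section
/- Let γ ∈ ℂ and let R(λ) be the trigonometric R-matrix (4×4, acting on ℂ²⊗ℂ²: R(λ)|00⟩=|00⟩, R(λ)|11⟩=|11⟩, R(λ)|01⟩=(sinλ/sin(λ+γ))|01⟩+(sinγ/sin(λ+γ))|10⟩, R(λ)|10⟩=(sinγ/sin(λ+γ))|01⟩+(sinλ/sin(λ+γ))|10⟩). Let N ≥ 2 be even and δ ∈ ℂ, and write λ_± = λ ± δ/2. For a ∈ Fin 2 and b ∈ Fin 2, let r_{ab}(λ) be the 2×2 block ⟨a|R(λ)|b⟩ with respect to the first (auxiliary) tensor factor, and let L_n(λ) be the 2×2 matrix, with entries n×n-site operators on (ℂ²)^{⊗N} ≅ ℂ^{2^N}, whose (a,b) entry acts as r_{ab}(λ) on site n and as the identity on all other sites. Define the staggered transfer matrix T(λ) := ∑_{a∈Fin 2} [L_1(λ_+)·L_2(λ_−)·L_3(λ_+)⋯L_N(λ_−)]_{aa} (trace over the auxiliary 2-dimensional space of the ordered product, sites alternating λ_+, λ_−). Then for all λ, μ ∈ ℂ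 such that sin(λ_±+γ) ≠ 0, sin(μ_±+γ) ≠ 0, sin(λ−μ+γ) ≠ 0 and sin(λ−μ−γ) ≠ 0 (so that all R-matrices involved are defined and R(λ−μ) is invertible), the transfer matrices commute: T(λ)·T(μ) = T(μ)·T(λ). -/
open Matrix

/-- The trigonometric `R`-matrix of the spin-1/2 XXZ model with anisotropy parameter
`γ`, acting on `ℂ² ⊗ ℂ²` (basis indexed by `Fin 2 × Fin 2`). -/
noncomputable def Rtrig (γ lam : ℂ) : Matrix (Fin 2 × Fin 2) (Fin 2 × Fin 2) ℂ :=
  Matrix.of fun p q =>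
    if p = q then (if p.1 = p.2 then 1 else Complex.sin lam / Complex.sin (lam + γ))
    else if p.1 = q.2 ∧ p.2 = q.1 ∧ p.1 ≠ p.2 then Complex.sin γ / Complex.sin (lam + γ)
    else 0

/-- The Lax operator at site `nn` of a chain of `N` spins-1/2: a `2 × 2` matrix (over
the auxiliary space) whose `(a,b)` entry acts as the block `⟨a|R(λ)|b⟩` on site `nn`
of `(ℂ²)^{⊗N}` and as the identity on all other sites. -/
noncomputable def laxOp (γ : ℂ) (N : ℕ) (nn : Fin N) (lam : ℂ) :
    Matrix (Fin 2) (Fin 2) (Matrix (Fin N → Fin 2) (Fin N → Fin 2) ℂ) :=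
  Matrix.of fun a b => Matrix.of fun σ τ =>
    if ∀ j : Fin N, j ≠ nn → σ j = τ j then Rtrig γ lam (a, σ nn) (b, τ nn) else 0

/-- The staggered (inhomogeneous) transfer matrix of the integrable Trotterization of
the XXZ chain: the trace over the auxiliary space of the ordered product of Lax
operators with spectral parameters alternating between `λ + δ/2` and `λ − δ/2`. -/
noncomputable def transferT (γ δ : ℂ) (N : ℕ) (lam : ℂ) :
    Matrix (Fin N → Fin 2) (Fin N → Fin 2) ℂ :=
  Matrix.trace
    ((List.ofFn fun nn : Fin N =>
      laxOp γ N nn (lam + if (nn : ℕ) % 2 = 0 then δ / 2 else -(δ / 2))).prod)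

/-- The embedding of single-site operators into the chain, acting at site `n`. -/
noncomputable def siteOp (N : ℕ) (n : Fin N) :
    Matrix (Fin 2) (Fin 2) ℂ →ₐ[ℂ] Matrix (Fin N → Fin 2) (Fin N → Fin 2) ℂ :=
  AlgHom.ofLinearMap
    { toFun := fun A => Matrix.of fun σ τ => if ∀ j, j ≠ n → σ j = τ j then A (σ n) (τ n) else 0
      map_add' := fun A B => by
        ext σ τ
        simp only [of_apply, Matrix.add_apply]
        split_ifs <;> simp
      map_smul' := fun c A => by
        ext σ τ
        simp }
    (by
      ext σ τ
      simp only [LinearMap.coe_mk, AddHom.coe_mk, of_apply, Matrix.one_apply, ← ite_and]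
      refine if_congr ⟨fun h => funext fun j => ?_, fun h => by simp [h]⟩ rfl rfl
      by_cases hj : j = n
      · exact hj ▸ h.2
      · exact h.1 j hj)
    (fun A B => by
      ext σ τ
      simp only [LinearMap.coe_mk, AddHom.coe_mk, of_apply, Matrix.mul_apply]
      have key : ∀ ρ : Fin N → Fin 2, (∀ j, j ≠ n → σ j = ρ j) →
          Function.update σ n (ρ n) = ρ := fun ρ h => funext fun j => by
        by_cases hj : j = n
        · subst hj; simp
        · simp [hj, h j hj]
      have hinj : Function.Injective (Function.update σ n) := Function.update_injective σ n
      rw [← Finset.sum_subset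
          (Finset.subset_univ ((Finset.univ : Finset (Fin 2)).image (Function.update σ n))),
        Finset.sum_image hinj.injOn]
      · by_cases h : ∀ j, j ≠ n → σ j = τ j
        · rw [if_pos h]
          refine Finset.sum_congr rfl fun x _ => ?_
          rw [if_pos (fun j hj => by simp [hj]), if_pos (fun j hj => by simp [hj, h j hj])]
          simp
        · rw [if_neg h]
          refine (Finset.sum_eq_zero fun x _ => ?_).symm
          have h' : ¬ ∀ j, j ≠ n → Function.update σ n x j = τ j :=
            fun h' => h fun j hj => by simpa [hj] using h' j hj
          rw [if_neg h', mul_zero]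
      · intro ρ _ hρ
        have h : ¬ ∀ j, j ≠ n → σ j = ρ j := fun h =>
          hρ (Finset.mem_image.2 ⟨ρ n, Finset.mem_univ _, key ρ h⟩)
        rw [if_neg h, zero_mul])

theorem siteOp_apply {N : ℕ} (n : Fin N) (A : Matrix (Fin 2) (Fin 2) ℂ) (σ τ : Fin N → Fin 2) :
    siteOp N n A σ τ = if ∀ j, j ≠ n → σ j = τ j then A (σ n) (τ n) else 0 := rfl

theorem siteOp_mul_siteOp_apply {N : ℕ} {m n : Fin N} (hmn : m ≠ n)
    (A B : Matrix (Fin 2) (Fin 2) ℂ) (σ τ : Fin N → Fin 2) :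
    (siteOp N m A * siteOp N n B) σ τ =
      if ∀ j, j ≠ m → j ≠ n → σ j = τ j then A (σ m) (τ m) * B (σ n) (τ n) else 0 := by
  rw [Matrix.mul_apply, Finset.sum_eq_single (Function.update σ m (τ m))]
  · rw [siteOp_apply, siteOp_apply, if_pos (fun j hj => by simp [hj])]
    have : (∀ j, j ≠ n → Function.update σ m (τ m) j = τ j) ↔
        ∀ j, j ≠ m → j ≠ n → σ j = τ j := by
      refine forall_congr' fun j => ?_
      by_cases hj : j = m
      · subst hj; simp
      · simp [hj]
    simp [this, hmn.symm]
  · intro ρ _ hρ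
    rw [siteOp_apply, siteOp_apply]
    split_ifs with h₁ h₂
    · refine absurd (funext fun j => ?_) hρ
      by_cases hj : j = m
      · subst hj; simp [h₂ _ hmn]
      · simp [hj, h₁ j hj]
    all_goals simp
  · simp

theorem siteOp_commute {N : ℕ} {m n : Fin N} (hmn : m ≠ n) (A B : Matrix (Fin 2) (Fin 2) ℂ) :
    Commute (siteOp N m A) (siteOp N n B) := by
  ext σ τ
  rw [siteOp_mul_siteOp_apply hmn, siteOp_mul_siteOp_apply hmn.symm]
  refine if_congr (forall_congr' fun j => ?_) (mul_comm _ _) rfl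
  tauto

/-- The blocks of the `R`-matrix with respect to the auxiliary space. -/
noncomputable def rBlock (γ lam : ℂ) :
    Matrix (Fin 2) (Fin 2) (Matrix (Fin 2) (Fin 2) ℂ) :=
  Matrix.of fun a b => Matrix.of fun s t => Rtrig γ lam (a, s) (b, t)

theorem laxOp_eq_map (γ : ℂ) (N : ℕ) (n : Fin N) (lam : ℂ) :
    laxOp γ N n lam = (rBlock γ lam).map (siteOp N n) := rfl

open scoped Kronecker

section Kronecker

variable {ι Q : Type*} [Fintype ι] [Ring Q]

theorem mul_kronecker_mul_of_commute (A A' B B' : Matrix ι ι Q)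
    (h : ∀ i j k l, Commute (A' i j) (B k l)) :
    (A * A') ⊗ₖ (B * B') = (A ⊗ₖ B) * (A' ⊗ₖ B') := by
  ext ⟨a, b⟩ ⟨c, d⟩
  simp only [kronecker_apply, Matrix.mul_apply, Fintype.sum_prod_type, Finset.sum_mul_sum]
  refine Finset.sum_congr rfl fun i _ => Finset.sum_congr rfl fun j _ => ?_
  rw [mul_assoc, ← mul_assoc (A' i c), (h _ _ _ _).eq]
  simp only [mul_assoc]

variable [DecidableEq ι]

theorem commute_list_prod_apply {l : List (Matrix ι ι Q)} {x : Q}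
    (h : ∀ A ∈ l, ∀ i j, Commute x (A i j)) (i j : ι) : Commute x (l.prod i j) := by
  induction l generalizing i with
  | nil =>
    rw [List.prod_nil, Matrix.one_apply]
    split_ifs
    exacts [Commute.one_right x, Commute.zero_right x]
  | cons A l ih =>
    rw [List.prod_cons, Matrix.mul_apply]
    exact Commute.sum_right _ _ _ fun k _ => (h A (by simp) i k).mul_right
      (ih (fun B hB => h B (by simp [hB])) k)

theorem prod_map_kronecker_prod_map {α : Type*} (X Y : α → Matrix ι ι Q)
    (hXY : ∀ m n, m ≠ n → ∀ i j k l, Commute (X m i j) (Y n k l)) {l : List α} (hl : l.Nodup) :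
    (l.map X).prod ⊗ₖ (l.map Y).prod = (l.map fun n => X n ⊗ₖ Y n).prod := by
  induction l with
  | nil => simp
  | cons n l ih =>
    obtain ⟨hn, hl⟩ := List.nodup_cons.1 hl
    simp only [List.map_cons, List.prod_cons, ← ih hl]
    refine mul_kronecker_mul_of_commute _ _ _ _ fun i j k m => ?_
    refine (commute_list_prod_apply (fun A hA i' j' => ?_) i j).symm
    obtain ⟨m', hm', rfl⟩ := List.mem_map.1 hA
    exact (hXY m' n (by rintro rfl; exact hn hm') _ _ _ _).symm

end Kronecker

/-- The six-vertex matrix with weights `a`, `b`, `c`. -/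
def sixVertex (a b c : ℂ) : Matrix (Fin 2 × Fin 2) (Fin 2 × Fin 2) ℂ :=
  Matrix.of fun p q =>
    if p = q then (if p.1 = p.2 then a else b)
    else if p.1 = q.2 ∧ p.2 = q.1 then c
    else 0

theorem Rtrig_eq_sixVertex (γ lam : ℂ) :
    Rtrig γ lam = sixVertex 1 (Complex.sin lam / Complex.sin (lam + γ))
      (Complex.sin γ / Complex.sin (lam + γ)) := by
  ext p q
  simp only [Rtrig, sixVertex, of_apply]
  split_ifs with h₁ h₂ h₃ h₄ <;> try rfl
  all_goals grind

/-- The matrix `sin (u + γ) • P R(u)` with `P` the permutation of the two tensor factors. -/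
noncomputable def braidR (γ u : ℂ) : Matrix (Fin 2 × Fin 2) (Fin 2 × Fin 2) ℂ :=
  sixVertex (Complex.sin (u + γ)) (Complex.sin γ) (Complex.sin u)

theorem braidR_mul_braidR_neg (γ u : ℂ) :
    braidR γ u * braidR γ (-u) = (-(Complex.sin (u + γ) * Complex.sin (u - γ))) • 1 := by
  have e : Complex.sin (-u + γ) = -Complex.sin (u - γ) := by
    rw [← Complex.sin_neg]; congr 1; ring
  have h : Complex.sin γ ^ 2 - Complex.sin u ^ 2 =
      -(Complex.sin (u + γ) * Complex.sin (u - γ)) := by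
    rw [Complex.sin_add, Complex.sin_sub]
    linear_combination Complex.sin u ^ 2 * Complex.sin_sq_add_cos_sq γ -
      Complex.sin γ ^ 2 * Complex.sin_sq_add_cos_sq u
  ext ⟨a, b⟩ ⟨c, d⟩
  fin_cases a <;> fin_cases b <;> fin_cases c <;> fin_cases d <;>
    simp [braidR, sixVertex, Matrix.mul_apply, Fintype.sum_prod_type, e] <;>
    first | ring1 | linear_combination h

set_option maxHeartbeats 2000000 in
/-- The Yang–Baxter equation for six-vertex matrices, in components. -/
theorem sixVertex_yang_baxter {a b c b' c' b'' c'' : ℂ}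
    (h₁ : a * c' = b * c' * b'' + c * c'')
    (h₂ : a * b' * c'' = b * c'' + c * c' * b'')
    (h₃ : c * b' = c * b'' + b * c' * c'')
    (p q : Fin 2 × Fin 2) (s t : Fin 2) :
    (∑ x : Fin 2 × Fin 2, sixVertex a c b p x *
        ∑ y, sixVertex 1 b' c' (x.1, s) (q.1, y) * sixVertex 1 b'' c'' (x.2, y) (q.2, t)) =
      ∑ x : Fin 2 × Fin 2,
        (∑ y, sixVertex 1 b'' c'' (p.1, s) (x.1, y) * sixVertex 1 b' c' (p.2, y) (x.2, t)) *
          sixVertex a c b x q := by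
  obtain ⟨i, j⟩ := p
  obtain ⟨k, l⟩ := q
  fin_cases i <;> fin_cases j <;> fin_cases k <;> fin_cases l <;> fin_cases s <;> fin_cases t <;>
    simp [sixVertex, Fintype.sum_prod_type] <;>
    first | ring1 | grind

theorem braidR_mul_rBlock_kronecker (γ lam mu : ℂ) (hl : Complex.sin (lam + γ) ≠ 0)
    (hm : Complex.sin (mu + γ) ≠ 0) :
    (braidR γ (lam - mu)).map (algebraMap ℂ (Matrix (Fin 2) (Fin 2) ℂ)) *
        (rBlock γ lam ⊗ₖ rBlock γ mu) =
      (rBlock γ mu ⊗ₖ rBlock γ lam) *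
        (braidR γ (lam - mu)).map (algebraMap ℂ (Matrix (Fin 2) (Fin 2) ℂ)) := by
  ext p q s t
  simp only [Matrix.mul_apply, Matrix.map_apply, kroneckerMap_apply, Matrix.sum_apply, rBlock,
    Rtrig_eq_sixVertex, braidR, ← Algebra.smul_def, ← Algebra.commutes, Matrix.smul_apply,
    smul_eq_mul, of_apply]
  simp only [mul_comm (sixVertex _ _ _ _ q)]
  have h₁ : Complex.sin (lam - mu + γ) * Complex.sin (mu + γ) =
      Complex.sin (lam - mu) * Complex.sin mu + Complex.sin γ * Complex.sin (lam + γ) := by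
    rw [show lam + γ = lam - mu + (mu + γ) by ring]
    simp only [Complex.sin_add, Complex.cos_add]
    linear_combination
      Complex.sin (lam - mu) * Complex.sin mu * Complex.sin_sq_add_cos_sq γ
  have h₂ : Complex.sin (lam - mu + γ) * Complex.sin lam =
      Complex.sin (lam - mu) * Complex.sin (lam + γ) + Complex.sin γ * Complex.sin mu := by
    rw [show Complex.sin mu = Complex.sin (lam - (lam - mu)) by rw [sub_sub_cancel]]
    rw [Complex.sin_sub lam (lam - mu), Complex.sin_add, Complex.sin_add]
    ring
  have h₃ : Complex.sin lam * Complex.sin (mu + γ) =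
      Complex.sin mu * Complex.sin (lam + γ) + Complex.sin (lam - mu) * Complex.sin γ := by
    rw [Complex.sin_sub, Complex.sin_add, Complex.sin_add]
    ring
  apply sixVertex_yang_baxter <;> field_simp
  · linear_combination Complex.sin γ * h₁
  · linear_combination Complex.sin γ * h₂
  · linear_combination Complex.sin γ * h₃

theorem braidR_mul_laxOp_kronecker (γ : ℂ) (N : ℕ) (n : Fin N) (lam mu : ℂ)
    (hl : Complex.sin (lam + γ) ≠ 0) (hm : Complex.sin (mu + γ) ≠ 0) :
    (braidR γ (lam - mu)).map (algebraMap ℂ (Matrix (Fin N → Fin 2) (Fin N → Fin 2) ℂ)) *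
        (laxOp γ N n lam ⊗ₖ laxOp γ N n mu) =
      (laxOp γ N n mu ⊗ₖ laxOp γ N n lam) *
        (braidR γ (lam - mu)).map (algebraMap ℂ (Matrix (Fin N → Fin 2) (Fin N → Fin 2) ℂ)) := by
  have hB : (braidR γ (lam - mu)).map
        (algebraMap ℂ (Matrix (Fin N → Fin 2) (Fin N → Fin 2) ℂ)) =
      ((braidR γ (lam - mu)).map (algebraMap ℂ (Matrix (Fin 2) (Fin 2) ℂ))).map
        (siteOp N n) := by
    ext1 p q
    simp only [Matrix.map_apply, AlgHom.commutes]
  have hL : ∀ x y, laxOp γ N n x ⊗ₖ laxOp γ N n y =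
      (rBlock γ x ⊗ₖ rBlock γ y).map (siteOp N n) := fun x y => by
    ext1 p q
    simp only [laxOp_eq_map, kroneckerMap_apply, Matrix.map_apply, map_mul]
  rw [hB, hL, hL, ← Matrix.map_mul, ← Matrix.map_mul, braidR_mul_rBlock_kronecker γ lam mu hl hm]

theorem mul_list_prod_eq_list_prod_mul {α M : Type*} [Monoid M] (r : M) (f g : α → M)
    (h : ∀ n, r * f n = g n * r) (l : List α) :
    r * (l.map f).prod = (l.map g).prod * r := by
  induction l with
  | nil => simp
  | cons n l ih =>
    simp only [List.map_cons, List.prod_cons, ← mul_assoc, h]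
    simp only [mul_assoc, ih]

theorem trace_map_algebraMap_mul_comm {ι K Q : Type*} [Fintype ι] [CommRing K] [Ring Q]
    [Algebra K Q] (A : Matrix ι ι K) (X : Matrix ι ι Q) :
    trace (A.map (algebraMap K Q) * X) = trace (X * A.map (algebraMap K Q)) := by
  simp only [trace, diag_apply, Matrix.mul_apply, Matrix.map_apply]
  rw [Finset.sum_comm]
  simp only [Algebra.commutes]

theorem trace_eq_of_map_algebraMap_mul_eq {ι K Q : Type*} [Fintype ι] [DecidableEq ι] [Field K]
    [Ring Q] [Algebra K Q] {A B : Matrix ι ι K} {c : K} (hc : c ≠ 0) (hAB : A * B = c • 1)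
    {X Y : Matrix ι ι Q}
    (h : A.map (algebraMap K Q) * X = Y * A.map (algebraMap K Q)) : trace X = trace Y := by
  have hA : A * (c⁻¹ • B) = 1 := by rw [mul_smul_comm, hAB, smul_smul, inv_mul_cancel₀ hc, one_smul]
  have hA' : (c⁻¹ • B) * A = 1 := mul_eq_one_comm.1 hA
  have hm : ∀ {C D : Matrix ι ι K}, C * D = 1 →
      C.map (algebraMap K Q) * D.map (algebraMap K Q) = 1 := fun {C D} hCD => by
    rw [← Matrix.map_mul, hCD, Matrix.map_one _ (map_zero _) (map_one _)]
  calc trace X = trace ((c⁻¹ • B).map (algebraMap K Q) * (A.map (algebraMap K Q) * X)) := by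
        rw [← mul_assoc, hm hA', one_mul]
    _ = trace Y := by
        rw [h, trace_map_algebraMap_mul_comm, mul_assoc, hm hA, mul_one]

theorem transferT_mul_transferT (γ δ : ℂ) (N : ℕ) (lam mu : ℂ) :
    transferT γ δ N lam * transferT γ δ N mu =
      trace ((List.finRange N).map fun n : Fin N =>
        laxOp γ N n (lam + if (n : ℕ) % 2 = 0 then δ / 2 else -(δ / 2)) ⊗ₖ
          laxOp γ N n (mu + if (n : ℕ) % 2 = 0 then δ / 2 else -(δ / 2))).prod := by
  rw [← prod_map_kronecker_prod_map _ _ _ (List.nodup_finRange N), trace_kronecker, transferT,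
    transferT, List.ofFn_eq_map, List.ofFn_eq_map]
  intro m n hmn i j k l
  exact siteOp_commute hmn (rBlock γ _ i j) (rBlock γ _ k l)

/-- **Commutativity of staggered transfer matrices** of the integrable Trotterization
of the XXZ spin-1/2 chain: `T(λ) T(μ) = T(μ) T(λ)` whenever all the `R`-matrices
involved are defined and `R(λ−μ)` is invertible. -/
theorem transfer_matrices_commute (γ δ : ℂ) (N : ℕ) (hN : 2 ≤ N) (hNe : Even N)
    (lam mu : ℂ)
    (hl1 : Complex.sin (lam + δ / 2 + γ) ≠ 0)
    (hl2 : Complex.sin (lam - δ / 2 + γ) ≠ 0)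
    (hm1 : Complex.sin (mu + δ / 2 + γ) ≠ 0)
    (hm2 : Complex.sin (mu - δ / 2 + γ) ≠ 0)
    (hlm1 : Complex.sin (lam - mu + γ) ≠ 0)
    (hlm2 : Complex.sin (lam - mu - γ) ≠ 0) :
    transferT γ δ N lam * transferT γ δ N mu = transferT γ δ N mu * transferT γ δ N lam := by
  have hp : ∀ n : ℕ, ∀ x : ℂ, Complex.sin (x + δ / 2 + γ) ≠ 0 → Complex.sin (x - δ / 2 + γ) ≠ 0 →
      Complex.sin (x + (if n % 2 = 0 then δ / 2 else -(δ / 2)) + γ) ≠ 0 := fun n x h₁ h₂ => by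
    split_ifs
    exacts [h₁, by rwa [← sub_eq_add_neg]]
  rw [transferT_mul_transferT, transferT_mul_transferT]
  refine trace_eq_of_map_algebraMap_mul_eq (neg_ne_zero.2 (mul_ne_zero hlm1 hlm2))
    (braidR_mul_braidR_neg γ (lam - mu)) (mul_list_prod_eq_list_prod_mul _ _ _ (fun n => ?_) _)
  have := braidR_mul_laxOp_kronecker γ N n _ _ (hp n lam hl1 hl2) (hp n mu hm1 hm2)
  rwa [add_sub_add_right_eq_sub] at this
end

section
/- Let m ≥ 3 be odd, let ℓ be a positive even integer with ℓ < m, and set γ = πℓ/m. Let s, β ∈ ℂ and define m×m complex matrices (indices k = 0,…,m−1, standard basis |k⟩): 𝐒^z = ∑_{k=0}^{m−1} (s−k)|k⟩⟨k|, 𝐒^+ = ∑_{k=0}^{m−2} (sin(γ(2s−k))/sin γ)|k⟩⟨k+1|, 𝐒^− = ∑_{k=0}^{m−2} (sin(γ(k+1))/sin γ)|k+1⟩⟨k| + β|0⟩⟨m−1| (the semicyclic representation). For λ ∈ ℂ with sin λ ≠ 0 define the Lax matrix on ℂ²⊗ℂ^m: 𝐋(λ) = I₂⊗cos(γ𝐒^z)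 + 2 cot λ · s^z⊗sin(γ𝐒^z) + csc λ · sin γ · (s^+⊗𝐒^− + s^−⊗𝐒^+), where s^z = diag(1/2,−1/2), s^+ = |0⟩⟨1|, s^− = |1⟩⟨0| on ℂ², and cos(γ𝐒^z), sin(γ𝐒^z) are the diagonal matrices with entries cos(γ(s−k)), sin(γ(s−k)). Let R(λ) be the trigonometric R-matrix with parameter γ. Then for all λ, μ ∈ ℂ with sin λ ≠ 0, sin μ ≠ 0 and sin(λ−μ+γ) ≠ 0, the RLL relation holds on ℂ²⊗ℂ²⊗ℂ^m: (R(λ−μ)⊗I_m)·𝐋₁(λ)·𝐋₂(μ) = 𝐋₂(μ)·𝐋₁(λ)·(R(λ−μ)⊗I_m), where 𝐋₁(λ) acts as 𝐋(λ) on the first ℂ² factor and ℂ^m and as identity on the second ℂ², and 𝐋₂(μ) acts as 𝐋(μ) on the second ℂ² factor and ℂ^m and as identity on the first ℂ². -/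
open Matrix Kronecker

/-- Spin-raising generator `𝐒⁺` of the semicyclic representation of `U_q(sl₂)`. -/
noncomputable def scSp (m : ℕ) (γ s : ℂ) : Matrix (Fin m) (Fin m) ℂ :=
  Matrix.of fun j k =>
    if (k : ℕ) = (j : ℕ) + 1 then Complex.sin (γ * (2 * s - (j : ℕ))) / Complex.sin γ
    else 0

/-- Spin-lowering generator `𝐒⁻` of the semicyclic representation of `U_q(sl₂)`,
including the cyclic term `β|0⟩⟨m−1|`. -/
noncomputable def scSm (m : ℕ) (γ β : ℂ) : Matrix (Fin m) (Fin m) ℂ :=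
  Matrix.of fun j k =>
    (if (j : ℕ) = (k : ℕ) + 1 then Complex.sin (γ * ((k : ℕ) + 1)) / Complex.sin γ
      else 0) +
    (if (j : ℕ) = 0 ∧ (k : ℕ) = m - 1 then β else 0)

/-- The spin-1/2 matrix `s^z = diag(1/2, −1/2)` on `ℂ²`. -/
noncomputable def sz2 : Matrix (Fin 2) (Fin 2) ℂ :=
  Matrix.diagonal fun i => if i = 0 then (1 / 2 : ℂ) else -(1 / 2)

/-- The spin-1/2 raising matrix `s⁺ = |0⟩⟨1|` on `ℂ²`. -/
noncomputable def sp2 : Matrix (Fin 2) (Fin 2) ℂ :=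
  Matrix.of fun i j => if i = 0 ∧ j = 1 then 1 else 0

/-- The spin-1/2 lowering matrix `s⁻ = |1⟩⟨0|` on `ℂ²`. -/
noncomputable def sm2 : Matrix (Fin 2) (Fin 2) ℂ :=
  Matrix.of fun i j => if i = 1 ∧ j = 0 then 1 else 0

/-- The Lax matrix of the semicyclic representation on `ℂ² ⊗ ℂᵐ`:
`𝐋(λ) = I₂ ⊗ cos(γ𝐒^z) + 2 cot λ · s^z ⊗ sin(γ𝐒^z)
        + csc λ · sin γ · (s⁺ ⊗ 𝐒⁻ + s⁻ ⊗ 𝐒⁺)`. -/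
noncomputable def scLax (m : ℕ) (γ s β lam : ℂ) :
    Matrix (Fin 2 × Fin m) (Fin 2 × Fin m) ℂ :=
  (1 : Matrix (Fin 2) (Fin 2) ℂ) ⊗ₖ
      Matrix.diagonal (fun k : Fin m => Complex.cos (γ * (s - (k : ℕ)))) +
    (2 * Complex.cos lam / Complex.sin lam) •
      (sz2 ⊗ₖ Matrix.diagonal fun k : Fin m => Complex.sin (γ * (s - (k : ℕ)))) +
    (Complex.sin γ / Complex.sin lam) • (sp2 ⊗ₖ scSm m γ β + sm2 ⊗ₖ scSp m γ s)

/-- `𝐋(λ)` acting on the first `ℂ²` factor and `ℂᵐ` of `ℂ² ⊗ ℂ² ⊗ ℂᵐ`. -/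
noncomputable def scLax1 (m : ℕ) (γ s β lam : ℂ) :
    Matrix (Fin 2 × Fin 2 × Fin m) (Fin 2 × Fin 2 × Fin m) ℂ :=
  Matrix.of fun p q =>
    if p.2.1 = q.2.1 then scLax m γ s β lam (p.1, p.2.2) (q.1, q.2.2) else 0

/-- `𝐋(μ)` acting on the second `ℂ²` factor and `ℂᵐ` of `ℂ² ⊗ ℂ² ⊗ ℂᵐ`. -/
noncomputable def scLax2 (m : ℕ) (γ s β mu : ℂ) :
    Matrix (Fin 2 × Fin 2 × Fin m) (Fin 2 × Fin 2 × Fin m) ℂ :=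
  Matrix.of fun p q =>
    if p.1 = q.1 then scLax m γ s β mu (p.2.1, p.2.2) (q.2.1, q.2.2) else 0

/-- `R(ν) ⊗ I_m` on `ℂ² ⊗ ℂ² ⊗ ℂᵐ`. -/
noncomputable def RtensorIm (m : ℕ) (γ ν : ℂ) :
    Matrix (Fin 2 × Fin 2 × Fin m) (Fin 2 × Fin 2 × Fin m) ℂ :=
  Matrix.of fun p q =>
    if p.2.2 = q.2.2 then Rtrig γ ν (p.1, p.2.1) (q.1, q.2.1) else 0

/-- The `ℂ²`-blocks of `sin λ • 𝐋(λ)`, for generators `C = cos(γ𝐒^z)`, `S = sin(γ𝐒^z)`,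
`P = 𝐒⁺`, `M = 𝐒⁻` in an arbitrary algebra and scalars `g = sin γ`, `x = sin λ`, `c = cos λ`. -/
def laxBlock {A : Type*} [Ring A] [Algebra ℂ A] (C S P M : A) (g x c : ℂ) : Fin 2 → Fin 2 → A :=
  ![![x • C + c • S, g • M], ![g • P, x • C - c • S]]

/-- The `RLL` relation in block form follows from the defining relations of `U_q(sl₂)`. -/
theorem laxBlock_RLL {A : Type*} [Ring A] [Algebra ℂ A] {C S P M : A} {γ : ℂ}
    (hγ : Complex.sin γ ≠ 0)
    (hSC : S * C = C * S) (hSS : S * S = 1 - C * C)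
    (hCM : C * M = Complex.cos γ • (M * C) + Complex.sin γ • (M * S))
    (hSM : S * M = Complex.cos γ • (M * S) - Complex.sin γ • (M * C))
    (hCP : C * P = Complex.cos γ • (P * C) - Complex.sin γ • (P * S))
    (hSP : S * P = Complex.cos γ • (P * S) + Complex.sin γ • (P * C))
    (hPM : P * M = M * P + (2 / Complex.sin γ) • (C * S))
    {lam mu : ℂ} (hD : Complex.sin (lam - mu + γ) ≠ 0) (a b a' b' : Fin 2) :
    ∑ c, ∑ d, Rtrig γ (lam - mu) (a, b) (c, d) •
        (laxBlock C S P M (Complex.sin γ) (Complex.sin lam) (Complex.cos lam) c a' *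
          laxBlock C S P M (Complex.sin γ) (Complex.sin mu) (Complex.cos mu) d b') =
      ∑ c, ∑ d, Rtrig γ (lam - mu) (c, d) (a', b') •
        (laxBlock C S P M (Complex.sin γ) (Complex.sin mu) (Complex.cos mu) b d *
          laxBlock C S P M (Complex.sin γ) (Complex.sin lam) (Complex.cos lam) a c) := by
  have hl := Complex.sin_sq_add_cos_sq lam
  have hm := Complex.sin_sq_add_cos_sq mu
  have hg := Complex.sin_sq_add_cos_sq γ
  have hD' := Complex.sin_add (lam - mu) γ
  rw [Complex.sin_sub, Complex.cos_sub] at hD'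
  have hb := Complex.sin_sub lam mu
  fin_cases a <;> fin_cases b <;> fin_cases a' <;> fin_cases b' <;>
    simp [Rtrig, laxBlock, Fin.sum_univ_two, mul_add, add_mul, mul_sub, sub_mul,
      hSC, hSS, hCM, hSM, hCP, hSP, hPM] <;>
    match_scalars <;>
    clear hSC hSS hCM hSM hCP hSP hPM <;>
    (try simp only [hb]) <;> clear hb <;>
    generalize Complex.sin (lam - mu + γ) = D at * <;>
    generalize Complex.sin lam = x at * <;> generalize Complex.cos lam = c at * <;>
    generalize Complex.sin mu = y at * <;> generalize Complex.cos mu = d at * <;>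
    generalize Complex.sin γ = g at * <;> generalize Complex.cos γ = k at * <;>
    field_simp <;> grind

section Semicyclic

variable {m : ℕ} {γ s β : ℂ}

/-- The diagonal matrix `cos(γ𝐒^z)`. -/
noncomputable def scCos (m : ℕ) (γ s : ℂ) : Matrix (Fin m) (Fin m) ℂ :=
  diagonal fun k => Complex.cos (γ * (s - (k : ℕ)))

/-- The diagonal matrix `sin(γ𝐒^z)`. -/
noncomputable def scSin (m : ℕ) (γ s : ℂ) : Matrix (Fin m) (Fin m) ℂ :=
  diagonal fun k => Complex.sin (γ * (s - (k : ℕ)))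

theorem scSin_mul_scCos : scSin m γ s * scCos m γ s = scCos m γ s * scSin m γ s := by
  simp only [scSin, scCos, diagonal_mul_diagonal, mul_comm]

theorem scSin_mul_scSin : scSin m γ s * scSin m γ s = 1 - scCos m γ s * scCos m γ s := by
  simp only [scSin, scCos, diagonal_mul_diagonal, ← diagonal_one, diagonal_sub]
  congr 1
  funext k
  linear_combination Complex.sin_sq_add_cos_sq (γ * (s - (k : ℕ)))

/-- The weights of `𝐒^z` at the two ends of a nonzero entry of `𝐒⁻` differ by one,
modulo the period of `cos(γ·)` and `sin(γ·)`. -/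
theorem exists_weight_of_scSm_ne_zero {r : ℕ} (hγ : γ * m = r * (2 * Real.pi)) {j k : Fin m}
    (h : scSm m γ β j k ≠ 0) :
    ∃ n : ℕ, γ * (s - (j : ℕ)) = γ * (s - (k : ℕ)) - γ + n * (2 * Real.pi) := by
  by_cases h1 : (j : ℕ) = (k : ℕ) + 1
  · refine ⟨0, ?_⟩
    rw [h1]
    push_cast
    ring
  · by_cases h2 : (j : ℕ) = 0 ∧ (k : ℕ) = m - 1
    · refine ⟨r, ?_⟩
      have hm : (m : ℂ) = (k : ℕ) + 1 := by
        have := k.isLt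
        exact_mod_cast (by omega : m = (k : ℕ) + 1)
      rw [hm] at hγ
      rw [h2.1]
      push_cast
      linear_combination hγ
    · simp [scSm, h1, h2] at h

theorem scCos_mul_scSm {r : ℕ} (hγ : γ * m = r * (2 * Real.pi)) :
    scCos m γ s * scSm m γ β =
      Complex.cos γ • (scSm m γ β * scCos m γ s) + Complex.sin γ • (scSm m γ β * scSin m γ s) := by
  ext j k
  simp only [scCos, scSin, diagonal_mul, mul_diagonal, Matrix.add_apply, Matrix.smul_apply,
    smul_eq_mul]
  by_cases h : scSm m γ β j k = 0
  · simp [h]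
  · obtain ⟨n, hn⟩ := exists_weight_of_scSm_ne_zero (s := s) hγ h
    rw [hn, Complex.cos_add_nat_mul_two_pi, Complex.cos_sub]
    ring

theorem scSin_mul_scSm {r : ℕ} (hγ : γ * m = r * (2 * Real.pi)) :
    scSin m γ s * scSm m γ β =
      Complex.cos γ • (scSm m γ β * scSin m γ s) - Complex.sin γ • (scSm m γ β * scCos m γ s) := by
  ext j k
  simp only [scCos, scSin, diagonal_mul, mul_diagonal, Matrix.sub_apply, Matrix.smul_apply,
    smul_eq_mul]
  by_cases h : scSm m γ β j k = 0
  · simp [h]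
  · obtain ⟨n, hn⟩ := exists_weight_of_scSm_ne_zero (s := s) hγ h
    rw [hn, Complex.sin_add_nat_mul_two_pi, Complex.sin_sub]
    ring

theorem weight_of_scSp_ne_zero {j k : Fin m} (h : scSp m γ s j k ≠ 0) :
    γ * (s - (j : ℕ)) = γ * (s - (k : ℕ)) + γ := by
  have h1 : (k : ℕ) = (j : ℕ) + 1 := by
    by_contra h1
    simp [scSp, h1] at h
  rw [h1]
  push_cast
  ring

theorem scCos_mul_scSp :
    scCos m γ s * scSp m γ s =
      Complex.cos γ • (scSp m γ s * scCos m γ s) - Complex.sin γ • (scSp m γ s * scSin m γ s) := by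
  ext j k
  simp only [scCos, scSin, diagonal_mul, mul_diagonal, Matrix.sub_apply, Matrix.smul_apply,
    smul_eq_mul]
  by_cases h : scSp m γ s j k = 0
  · simp [h]
  · rw [weight_of_scSp_ne_zero h, Complex.cos_add]
    ring

theorem scSin_mul_scSp :
    scSin m γ s * scSp m γ s =
      Complex.cos γ • (scSp m γ s * scSin m γ s) + Complex.sin γ • (scSp m γ s * scCos m γ s) := by
  ext j k
  simp only [scCos, scSin, diagonal_mul, mul_diagonal, Matrix.add_apply, Matrix.smul_apply,
    smul_eq_mul]
  by_cases h : scSp m γ s j k = 0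
  · simp [h]
  · rw [weight_of_scSp_ne_zero h, Complex.sin_add]
    ring

theorem scSp_mul_scSm (hγ : Complex.sin (γ * m) = 0) :
    scSp m γ s * scSm m γ β =
      diagonal fun j : Fin m => Complex.sin (γ * (2 * s - (j : ℕ))) / Complex.sin γ *
        (Complex.sin (γ * ((j : ℕ) + 1)) / Complex.sin γ) := by
  ext j k
  rw [mul_apply]
  by_cases hj : (j : ℕ) + 1 < m
  · rw [Finset.sum_eq_single (⟨j + 1, hj⟩ : Fin m)]
    · by_cases h : j = k
      · subst h
        simp [scSp, scSm]
      · have h' : (j : ℕ) ≠ k := fun e => h (Fin.ext e)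
        simp [scSm, h, h']
    · intro i _ hi
      have h' : (i : ℕ) ≠ j + 1 := fun e => hi (Fin.ext e)
      simp [scSp, h']
    · simp
  · have hm : (m : ℂ) = (j : ℕ) + 1 := by
      have := j.isLt
      exact_mod_cast (by omega : m = (j : ℕ) + 1)
    rw [Finset.sum_eq_zero]
    · by_cases h : j = k
      · subst h
        rw [diagonal_apply_eq, ← hm, hγ]
        simp
      · rw [diagonal_apply_ne _ h]
    · intro i _
      have h' : (i : ℕ) ≠ j + 1 := by
        have := i.isLt
        omega
      simp [scSp, h']

theorem scSm_mul_scSp :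
    scSm m γ β * scSp m γ s =
      diagonal fun j : Fin m => Complex.sin (γ * (j : ℕ)) / Complex.sin γ *
        (Complex.sin (γ * (2 * s - (j : ℕ) + 1)) / Complex.sin γ) := by
  ext j k
  rw [mul_apply]
  by_cases hk : (k : ℕ) = 0
  · rw [Finset.sum_eq_zero]
    · by_cases h : j = k
      · subst h
        simp [hk]
      · rw [diagonal_apply_ne _ h]
    · intro i _
      simp [scSp, hk]
  · obtain ⟨n, hn⟩ := Nat.exists_eq_succ_of_ne_zero hk
    have hkm := k.isLt
    rw [Finset.sum_eq_single (⟨n, by omega⟩ : Fin m)]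
    · have hnm : n ≠ m - 1 := by omega
      by_cases h : j = k
      · subst h
        simp only [scSm, scSp, of_apply, hn, diagonal_apply_eq, hnm]
        simp only [Nat.succ_eq_add_one, if_true, and_false, if_false]
        push_cast
        ring_nf
      · have h' : (j : ℕ) ≠ n + 1 := fun e => h (Fin.ext (e.trans hn.symm))
        simp [scSm, h, h', hnm]
    · intro i _ hi
      have h' : (k : ℕ) ≠ i + 1 := fun e => hi (Fin.ext (by simp; omega))
      simp [scSp, h']
    · simp

theorem scSp_mul_scSm_eq_add (hsin : Complex.sin γ ≠ 0) (hγ : Complex.sin (γ * m) = 0) :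
    scSp m γ s * scSm m γ β =
      scSm m γ β * scSp m γ s + (2 / Complex.sin γ) • (scCos m γ s * scSin m γ s) := by
  rw [scSp_mul_scSm hγ, scSm_mul_scSp, scCos, scSin, diagonal_mul_diagonal, ← diagonal_smul,
    diagonal_add]
  congr 1
  funext j
  simp only [Pi.smul_apply, smul_eq_mul]
  have h1 : γ * ((j : ℕ) + 1) = γ * (j : ℕ) + γ := by ring
  have h2 : γ * (2 * s - (j : ℕ) + 1) = γ * (2 * s - (j : ℕ)) + γ := by ring
  have h3 := Complex.sin_two_mul (γ * (s - (j : ℕ)))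
  rw [show 2 * (γ * (s - (j : ℕ))) = γ * (2 * s - (j : ℕ)) - γ * (j : ℕ) by ring,
    Complex.sin_sub] at h3
  rw [h1, h2, Complex.sin_add, Complex.sin_add]
  field_simp
  linear_combination Complex.sin γ * h3

theorem scLax_apply {lam : ℂ} (hlam : Complex.sin lam ≠ 0) (a b : Fin 2) (j k : Fin m) :
    scLax m γ s β lam (a, j) (b, k) = (Complex.sin lam)⁻¹ *
      laxBlock (scCos m γ s) (scSin m γ s) (scSp m γ s) (scSm m γ β)
        (Complex.sin γ) (Complex.sin lam) (Complex.cos lam) a b j k := by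
  fin_cases a <;> fin_cases b <;>
    simp [scLax, laxBlock, sz2, sp2, sm2, scCos, scSin, kroneckerMap_apply] <;>
    field_simp
  ring

theorem RtensorIm_mul_scLax1_mul_scLax2_apply {lam mu : ℂ} (hlam : Complex.sin lam ≠ 0)
    (hmu : Complex.sin mu ≠ 0) (a b a' b' : Fin 2) (j k : Fin m) (ν : ℂ) :
    (RtensorIm m γ ν * scLax1 m γ s β lam * scLax2 m γ s β mu) (a, b, j) (a', b', k) =
      (Complex.sin lam)⁻¹ * (Complex.sin mu)⁻¹ *
      (∑ c, ∑ d, Rtrig γ ν (a, b) (c, d) •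
        (laxBlock (scCos m γ s) (scSin m γ s) (scSp m γ s) (scSm m γ β)
            (Complex.sin γ) (Complex.sin lam) (Complex.cos lam) c a' *
          laxBlock (scCos m γ s) (scSin m γ s) (scSp m γ s) (scSm m γ β)
            (Complex.sin γ) (Complex.sin mu) (Complex.cos mu) d b')) j k := by
  rw [Matrix.mul_assoc]
  simp only [mul_apply, Fintype.sum_prod_type, RtensorIm, scLax1, scLax2, of_apply,
    scLax_apply hlam, scLax_apply hmu, Matrix.sum_apply, Matrix.smul_apply, smul_eq_mul, ite_mul,
    mul_ite, zero_mul, mul_zero, Finset.sum_ite_eq, Finset.sum_ite_eq', Finset.mem_univ, if_true,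
    Finset.sum_ite_irrel, Finset.sum_const_zero, Finset.mul_sum]
  refine Finset.sum_congr rfl fun c _ => Finset.sum_congr rfl fun d _ =>
    Finset.sum_congr rfl fun i _ => ?_
  ring

theorem scLax2_mul_scLax1_mul_RtensorIm_apply {lam mu : ℂ} (hlam : Complex.sin lam ≠ 0)
    (hmu : Complex.sin mu ≠ 0) (a b a' b' : Fin 2) (j k : Fin m) (ν : ℂ) :
    (scLax2 m γ s β mu * scLax1 m γ s β lam * RtensorIm m γ ν) (a, b, j) (a', b', k) =
      (Complex.sin lam)⁻¹ * (Complex.sin mu)⁻¹ *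
      (∑ c, ∑ d, Rtrig γ ν (c, d) (a', b') •
        (laxBlock (scCos m γ s) (scSin m γ s) (scSp m γ s) (scSm m γ β)
            (Complex.sin γ) (Complex.sin mu) (Complex.cos mu) b d *
          laxBlock (scCos m γ s) (scSin m γ s) (scSp m γ s) (scSm m γ β)
            (Complex.sin γ) (Complex.sin lam) (Complex.cos lam) a c)) j k := by
  simp only [mul_apply, Fintype.sum_prod_type, RtensorIm, scLax1, scLax2, of_apply,
    scLax_apply hlam, scLax_apply hmu, Matrix.sum_apply, Matrix.smul_apply, smul_eq_mul, ite_mul,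
    mul_ite, zero_mul, mul_zero, Finset.sum_ite_eq, Finset.sum_ite_eq', Finset.mem_univ, if_true,
    Finset.sum_ite_irrel, Finset.sum_const_zero, Finset.mul_sum, Finset.sum_mul]
  refine Finset.sum_congr rfl fun c _ => Finset.sum_congr rfl fun d _ =>
    Finset.sum_congr rfl fun i _ => ?_
  ring

end Semicyclic

/-- **RLL relation** for the semicyclic Lax matrix of the Floquet driven XXZ chain at
root-of-unity anisotropy `γ = πℓ/m` (`m ≥ 3` odd, `ℓ` even, `0 < ℓ < m`):
`(R(λ−μ) ⊗ I_m) 𝐋₁(λ) 𝐋₂(μ) = 𝐋₂(μ) 𝐋₁(λ) (R(λ−μ) ⊗ I_m)`. -/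
theorem semicyclic_RLL_relation (m : ℕ) (hm : 3 ≤ m) (hmodd : Odd m)
    (l : ℕ) (hl : Even l) (hlpos : 0 < l) (hlm : l < m)
    (γ : ℂ) (hγ : γ = Real.pi * l / m)
    (s β : ℂ) (lam mu : ℂ)
    (hlam : Complex.sin lam ≠ 0) (hmu : Complex.sin mu ≠ 0)
    (hlm' : Complex.sin (lam - mu + γ) ≠ 0) :
    RtensorIm m γ (lam - mu) * scLax1 m γ s β lam * scLax2 m γ s β mu =
      scLax2 m γ s β mu * scLax1 m γ s β lam * RtensorIm m γ (lam - mu) := by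
  have hm0 : (m : ℂ) ≠ 0 := by
    exact_mod_cast (by omega : m ≠ 0)
  obtain ⟨r, hr⟩ := hl
  have hγm : γ * m = r * (2 * Real.pi) := by
    rw [hγ, hr]
    push_cast
    field_simp
    ring
  have hsinm : Complex.sin (γ * m) = 0 := by
    rw [hγm]
    simpa using Complex.sin_add_nat_mul_two_pi 0 r
  have hsin : Complex.sin γ ≠ 0 := by
    have hmpos : (0 : ℝ) < m := by exact_mod_cast (by omega : 0 < m)
    have hlpos' : (0 : ℝ) < l := by exact_mod_cast hlpos
    have hlm'' : (l : ℝ) < m := by exact_mod_cast hlm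
    have h : 0 < Real.sin (Real.pi * l / m) := by
      apply Real.sin_pos_of_pos_of_lt_pi
      · positivity
      · rw [div_lt_iff₀ hmpos]
        exact mul_lt_mul_of_pos_left hlm'' Real.pi_pos
    rw [hγ]
    exact_mod_cast h.ne'
  ext ⟨a, b, j⟩ ⟨a', b', k⟩
  rw [RtensorIm_mul_scLax1_mul_scLax2_apply hlam hmu,
    scLax2_mul_scLax1_mul_RtensorIm_apply hlam hmu,
    laxBlock_RLL hsin scSin_mul_scCos scSin_mul_scSin (scCos_mul_scSm hγm) (scSin_mul_scSm hγm)
      scCos_mul_scSp scSin_mul_scSp (scSp_mul_scSm_eq_add hsin hsinm) hlm']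
end
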